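/- Let K ⊆ ℝⁿ be a nonempty compact set. For λ > 0 define the λ-medial set A_λ := { p ∈ ℝⁿ \ K : |∇d_K|(p)² ≤ 1 − λ²/d_K(p)² }. Then the union ⋃_{λ>0} A_λ is exactly the set of points p ∈ ℝⁿ \ K having at least two distinct nearest points on K (the medial axis of the complement of K). -/

import Mathlib

open Filter Metric Set

noncomputable section

/-- Euclidean space `ℝⁿ`. -/
abbrev Euc (n : ℕ) := EuclideanSpace ℝ (Fin n)

/-- `u` is `C`-semiconcave on a (convex) set `S`: for all `x y ∈ S` and `l ∈ [0,1]`,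
`(1-l)·u x + l·u y - u((1-l)x + l y) ≤ C·l·(1-l)·‖x-y‖²`. -/
def SemiconcaveOn {n : ℕ} (C : ℝ) (S : Set (Euc n)) (u : Euc n → ℝ) : Prop :=
  ∀ x ∈ S, ∀ y ∈ S, ∀ l : ℝ, 0 ≤ l → l ≤ 1 →
    (1 - l) * u x + l * u y - u ((1 - l) • x + l • y) ≤ C * l * (1 - l) * ‖x - y‖ ^ 2

/-- The one-sided directional derivative of `u` at `p` in direction `v` exists and equals `d`. -/
def HasPosDirDeriv {n : ℕ} (u : Euc n → ℝ) (p v : Euc n) (d : ℝ) : Prop :=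
  Tendsto (fun t : ℝ => (u (p + t • v) - u p) / t) (nhdsWithin 0 (Ioi 0)) (nhds d)

/-- The one-sided directional derivative `∂⁺_v u(p)` (junk value if the limit does not exist). -/
def posDirDeriv {n : ℕ} (u : Euc n → ℝ) (p v : Euc n) : ℝ :=
  limUnder (nhdsWithin 0 (Ioi 0)) (fun t : ℝ => (u (p + t • v) - u p) / t)

/-- The norm of the generalized gradient: `|∇u|(p) = max(0, sup_{‖v‖=1} ∂⁺_v u(p))`. -/
def gradNorm {n : ℕ} (u : Euc n → ℝ) (p : Euc n) : ℝ :=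
  max 0 (sSup {d : ℝ | ∃ v : Euc n, ‖v‖ = 1 ∧ d = posDirDeriv u p v})

/-- Subgradient inequality for the norm of an inner product space. -/
theorem norm_sub_norm_le_inner_div {E : Type*} [NormedAddCommGroup E] [InnerProductSpace ℝ E]
    (a b : E) : ‖b‖ - ‖a‖ ≤ inner ℝ (b - a) b / ‖b‖ := by
  rcases eq_or_ne b 0 with rfl | hb
  · simp
  · have hb' : 0 < ‖b‖ := norm_pos_iff.mpr hb
    rw [le_div_iff₀ hb', inner_sub_left, real_inner_self_eq_norm_sq]
    nlinarith [real_inner_le_norm a b]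

/-- At a point off a compact set `K`, the one-sided directional derivative of the distance to `K`
in direction `v` exists, and it is the minimum of `⟪v, p - y⟫ / ‖p - y‖` over the points `y` of `K`
nearest to `p`. -/
theorem exists_hasPosDirDeriv_infDist {n : ℕ} {K : Set (Euc n)} (hne : K.Nonempty)
    (hK : IsCompact K) {p : Euc n} (hp : p ∉ K) (v : Euc n) :
    ∃ y ∈ K, dist p y = infDist p K ∧
      HasPosDirDeriv (fun x => infDist x K) p v (inner ℝ v (p - y) / ‖p - y‖) ∧
      ∀ z ∈ K, dist p z = infDist p K →
        inner ℝ v (p - y) / ‖p - y‖ ≤ inner ℝ v (p - z) / ‖p - z‖ := by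
  have hpos : ∀ y ∈ K, 0 < ‖p - y‖ := fun y hy =>
    norm_pos_iff.mpr (sub_ne_zero.mpr fun h => hp (h ▸ hy))
  have hg : ContinuousOn (fun y : Euc n => inner ℝ v (p - y) / ‖p - y‖) K :=
    ContinuousOn.div (by fun_prop) (by fun_prop) fun y hy => (hpos y hy).ne'
  have hnear : IsCompact (K ∩ {y | dist p y = infDist p K}) :=
    hK.inter_right (isClosed_eq (by fun_prop) continuous_const)
  obtain ⟨y₀, hy₀, hy₀d⟩ := hK.exists_infDist_eq_dist hne p
  obtain ⟨y, ⟨hyK, hyd⟩, hmin⟩ :=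
    hnear.exists_isMinOn ⟨y₀, hy₀, hy₀d.symm⟩ (hg.mono inter_subset_left)
  have hmin' : ∀ z ∈ K, dist p z = infDist p K →
      inner ℝ v (p - y) / ‖p - y‖ ≤ inner ℝ v (p - z) / ‖p - z‖ :=
    fun z hz hzd => hmin ⟨hz, hzd⟩
  refine ⟨y, hyK, hyd, ?_, hmin'⟩
  have hupper : Tendsto (fun t : ℝ => inner ℝ v (p + t • v - y) / ‖p + t • v - y‖)
      (nhdsWithin 0 (Ioi 0)) (nhds (inner ℝ v (p - y) / ‖p - y‖)) := by
    have hc : ContinuousAt (fun t : ℝ => inner ℝ v (p + t • v - y) / ‖p + t • v - y‖) 0 :=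
      ContinuousAt.div (by fun_prop) (by fun_prop) (by simpa using (hpos y hyK).ne')
    have := hc.tendsto
    simp only [zero_smul, add_zero] at this
    exact this.mono_left nhdsWithin_le_nhds
  refine tendsto_order.mpr ⟨fun c hc => ?_, fun c hc => ?_⟩
  · have hbad : IsCompact (K ∩ (fun z : Euc n => inner ℝ v (p - z) / ‖p - z‖) ⁻¹' Iic c) :=
      hK.of_isClosed_subset (hg.preimage_isClosed_of_isClosed hK.isClosed isClosed_Iic)
        inter_subset_left
    obtain ⟨r, hr, hfar⟩ : ∃ r, infDist p K < r ∧
        ∀ z ∈ K, inner ℝ v (p - z) / ‖p - z‖ ≤ c → r ≤ dist p z := by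
      rcases (K ∩ (fun z : Euc n => inner ℝ v (p - z) / ‖p - z‖) ⁻¹' Iic c).eq_empty_or_nonempty
        with he | hn
      · refine ⟨infDist p K + 1, by linarith, fun z hz hzc => ?_⟩
        have hmem : z ∈ K ∩ (fun z : Euc n => inner ℝ v (p - z) / ‖p - z‖) ⁻¹' Iic c := ⟨hz, hzc⟩
        rw [he] at hmem
        exact hmem.elim
      · obtain ⟨w, ⟨hwK, hwc⟩, hw⟩ := hbad.exists_isMinOn hn
          (f := fun z => dist p z) (by fun_prop)
        refine ⟨dist p w, lt_of_le_of_ne (infDist_le_dist_of_mem hwK) fun h => ?_,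
          fun z hz hzc => hw ⟨hz, hzc⟩⟩
        exact absurd (hmin' w hwK h.symm) (not_le.mpr (lt_of_le_of_lt hwc hc))
    have hsmall : ∀ᶠ t : ℝ in nhdsWithin 0 (Ioi 0),
        infDist (p + t • v) K + dist p (p + t • v) < r := by
      have hc' : Continuous fun t : ℝ => infDist (p + t • v) K + dist p (p + t • v) :=
        ((continuous_infDist_pt K).comp (by fun_prop)).add (by fun_prop)
      have := hc'.tendsto 0
      simp only [zero_smul, add_zero, dist_self] at this
      exact (this.mono_left nhdsWithin_le_nhds).eventually_lt_const hr
    filter_upwards [hsmall, self_mem_nhdsWithin] with t ht ht0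
    have ht0 : 0 < t := ht0
    obtain ⟨z, hz, hzd⟩ := hK.exists_infDist_eq_dist hne (p + t • v)
    have hzc : c < inner ℝ v (p - z) / ‖p - z‖ := by
      by_contra! h
      linarith [hfar z hz h, dist_triangle p (p + t • v) z]
    refine hzc.trans_le ?_
    rw [le_div_iff₀ ht0]
    have h1 := norm_sub_norm_le_inner_div (p + t • v - z) (p - z)
    have h2 : p - z - (p + t • v - z) = -(t • v) := by abel
    rw [h2, inner_neg_left, real_inner_smul_left, neg_div, mul_div_assoc] at h1
    have h3 : infDist p K ≤ ‖p - z‖ := dist_eq_norm p z ▸ infDist_le_dist_of_mem hz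
    rw [dist_eq_norm] at hzd
    linarith
  · filter_upwards [hupper.eventually_lt_const hc, self_mem_nhdsWithin] with t ht ht0
    have ht0 : 0 < t := ht0
    refine lt_of_le_of_lt ?_ ht
    rw [div_le_iff₀ ht0]
    have h1 := norm_sub_norm_le_inner_div (p - y) (p + t • v - y)
    have h2 : p + t • v - y - (p - y) = t • v := by abel
    rw [h2, real_inner_smul_left, mul_div_assoc] at h1
    have h3 : infDist (p + t • v) K ≤ ‖p + t • v - y‖ :=
      dist_eq_norm (p + t • v) y ▸ infDist_le_dist_of_mem hyK
    rw [mem_ofPred_eq, dist_eq_norm] at hyd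
    linarith

theorem HasPosDirDeriv.posDirDeriv_eq {n : ℕ} {u : Euc n → ℝ} {p v : Euc n} {d : ℝ}
    (h : HasPosDirDeriv u p v d) : posDirDeriv u p v = d :=
  h.limUnder_eq

theorem posDirDeriv_infDist_le_one {n : ℕ} {K : Set (Euc n)} (hne : K.Nonempty)
    (hK : IsCompact K) {p : Euc n} (hp : p ∉ K) {v : Euc n} (hv : ‖v‖ = 1) :
    posDirDeriv (fun x => infDist x K) p v ≤ 1 := by
  obtain ⟨y, -, -, hd, -⟩ := exists_hasPosDirDeriv_infDist hne hK hp v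
  rw [hd.posDirDeriv_eq]
  refine div_le_one_of_le₀ ?_ (norm_nonneg _)
  simpa [hv] using real_inner_le_norm v (p - y)

/-- A point with a unique nearest point on `K` has generalized gradient norm at least one. -/
theorem one_le_gradNorm_infDist {n : ℕ} {K : Set (Euc n)} (hne : K.Nonempty)
    (hK : IsCompact K) {p : Euc n} (hp : p ∉ K) {y : Euc n}
    (hy : ∀ z ∈ K, dist p z = infDist p K → z = y) :
    1 ≤ gradNorm (fun x => infDist x K) p := by
  obtain ⟨z, hzK, hzd, hd, -⟩ :=
    exists_hasPosDirDeriv_infDist hne hK hp (‖p - y‖⁻¹ • (p - y))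
  obtain rfl := hy z hzK hzd
  have hpos : ‖p - z‖ ≠ 0 := norm_ne_zero_iff.mpr (sub_ne_zero.mpr fun h => hp (h ▸ hzK))
  refine le_max_of_le_right (le_csSup ⟨1, ?_⟩ ⟨‖p - z‖⁻¹ • (p - z), ?_, ?_⟩)
  · rintro _ ⟨v, hv, rfl⟩
    exact posDirDeriv_infDist_le_one hne hK hp hv
  · rw [norm_smul, norm_inv, norm_norm, inv_mul_cancel₀ hpos]
  · rw [hd.posDirDeriv_eq, real_inner_smul_left, real_inner_self_eq_norm_sq]
    field_simp

/-- Two nearest points `y₁, y₂` bound the generalized gradient norm by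
`√(1 - (‖y₁ - y₂‖ / 2)² / d_K(p)²)`. -/
theorem gradNorm_infDist_sq_le {n : ℕ} {K : Set (Euc n)} (hne : K.Nonempty)
    (hK : IsCompact K) {p : Euc n} (hp : p ∉ K) {y₁ y₂ : Euc n} (h₁ : y₁ ∈ K) (h₂ : y₂ ∈ K)
    (hd₁ : dist p y₁ = infDist p K) (hd₂ : dist p y₂ = infDist p K) :
    gradNorm (fun x => infDist x K) p ^ 2 ≤ 1 - (‖y₁ - y₂‖ / 2) ^ 2 / infDist p K ^ 2 := by
  have hR : 0 < infDist p K := hd₁ ▸ dist_pos.mpr fun h => hp (h ▸ h₁)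
  have hn₁ := hd₁
  have hn₂ := hd₂
  rw [dist_eq_norm] at hn₁ hn₂
  have hpar : ‖p - y₁ + (p - y₂)‖ ^ 2 = 4 * infDist p K ^ 2 - ‖y₁ - y₂‖ ^ 2 := by
    have h := parallelogram_law_with_norm ℝ (p - y₁) (p - y₂)
    rw [show p - y₁ - (p - y₂) = -(y₁ - y₂) by abel, norm_neg, hn₁, hn₂] at h
    linarith
  have hbound : gradNorm (fun x => infDist x K) p ≤
      ‖p - y₁ + (p - y₂)‖ / (2 * infDist p K) := by
    refine max_le (by positivity) (Real.sSup_le ?_ (by positivity))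
    rintro _ ⟨v, hv, rfl⟩
    obtain ⟨y, -, -, hd, hmin⟩ := exists_hasPosDirDeriv_infDist hne hK hp v
    rw [hd.posDirDeriv_eq]
    have hm₁ := hmin y₁ h₁ hd₁
    have hm₂ := hmin y₂ h₂ hd₂
    rw [hn₁, le_div_iff₀ hR] at hm₁
    rw [hn₂, le_div_iff₀ hR] at hm₂
    have hcs := real_inner_le_norm v (p - y₁ + (p - y₂))
    rw [hv, one_mul, inner_add_right] at hcs
    rw [le_div_iff₀ (by positivity)]
    linarith
  calc gradNorm (fun x => infDist x K) p ^ 2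
      ≤ (‖p - y₁ + (p - y₂)‖ / (2 * infDist p K)) ^ 2 :=
        pow_le_pow_left₀ (le_max_left _ _) hbound 2
    _ = 1 - (‖y₁ - y₂‖ / 2) ^ 2 / infDist p K ^ 2 := by
        rw [div_pow, hpar]
        field_simp
        ring

theorem stmt15 {n : ℕ} (K : Set (Euc n)) (hne : K.Nonempty) (hK : IsCompact K) :
    (⋃ lam ∈ Set.Ioi (0 : ℝ),
      {p : Euc n | p ∉ K ∧ (gradNorm (fun x => Metric.infDist x K) p) ^ 2 ≤
        1 - lam ^ 2 / (Metric.infDist p K) ^ 2}) =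
    {p : Euc n | p ∉ K ∧ ∃ y₁ ∈ K, ∃ y₂ ∈ K, y₁ ≠ y₂ ∧
      dist p y₁ = Metric.infDist p K ∧ dist p y₂ = Metric.infDist p K} := by
  ext p
  simp only [mem_iUnion, mem_ofPred_eq, mem_Ioi, exists_prop]
  constructor
  · rintro ⟨lam, hlam, hp, hle⟩
    refine ⟨hp, ?_⟩
    obtain ⟨y, hyK, hyd⟩ := hK.exists_infDist_eq_dist hne p
    by_contra! hcon
    have hone := one_le_gradNorm_infDist hne hK hp (y := y) fun z hz hzd => by
      by_contra hzy
      exact hcon z hz y hyK hzy hzd hyd.symm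
    have hR : 0 < infDist p K := hyd ▸ dist_pos.mpr fun h => hp (h ▸ hyK)
    have hquot : 0 < lam ^ 2 / infDist p K ^ 2 := by positivity
    nlinarith
  · rintro ⟨hp, y₁, h₁, y₂, h₂, hy, hd₁, hd₂⟩
    have hnorm : 0 < ‖y₁ - y₂‖ := norm_pos_iff.mpr (sub_ne_zero.mpr hy)
    exact ⟨‖y₁ - y₂‖ / 2, by positivity, hp,
      gradNorm_infDist_sq_le hne hK hp h₁ h₂ hd₁ hd₂⟩
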